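/- Let h̄ > 0, λ_N ≥ λ₂ > 0, and 0 < μ₁ < μ₂. The system of inequalities 2(μ₂−μ₁)/(h̄λ_N(μ₁+μ₂+h̄)) > k₁ > 0, min{2/(h̄λ_N), 4/(λ_N(2μ₁+h̄))} > k₂ > 4/(λ₂(μ₁+μ₂)), and 4/(λ_N(μ₁+μ₂+h̄)) > k₂ − k₁ > 0 admits a solution (k₁, k₂) ∈ ℝ² if and only if (μ₁+μ₂)/(h̄ + max{h̄, 2μ₁}) > λ_N/λ₂. -/

import Mathlib

theorem min_two_div_four_div_eq {h l m : ℝ} (hh : 0 < h) (hl : 0 < l) (hm : 0 < m) :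
    min (2 / (h * l)) (4 / (l * (2 * m + h))) = 4 / (l * (h + max h (2 * m))) := by
  have e : 2 / (h * l) = 4 / (l * (h + h)) := by field_simp; norm_num
  rcases le_total h (2 * m) with hle | hle
  · rw [max_eq_right hle, add_comm h, e]
    apply min_eq_right
    gcongr
  · rw [max_eq_left hle, e]
    apply min_eq_left
    gcongr

theorem min_le_add_gain_bounds {h l m₁ m₂ : ℝ} (hh : 0 < h) (hl : 0 < l) (hm₁ : 0 < m₁)
    (hm : m₁ < m₂) :
    min (2 / (h * l)) (4 / (l * (2 * m₁ + h))) ≤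
      2 * (m₂ - m₁) / (h * l * (m₁ + m₂ + h)) + 4 / (l * (m₁ + m₂ + h)) := by
  have hm₂ : 0 < m₂ := hm₁.trans hm
  have e : 2 * (m₂ - m₁) / (h * l * (m₁ + m₂ + h)) + 4 / (l * (m₁ + m₂ + h)) =
      (2 * (m₂ - m₁) + 4 * h) / (h * l * (m₁ + m₂ + h)) := by
    field_simp
  rw [e]
  rcases le_total h (2 * m₁) with hle | hle
  · refine (min_le_right _ _).trans ?_
    rw [div_le_div_iff₀ (by positivity) (by positivity)]
    have key : 4 * (h * (m₁ + m₂ + h)) ≤ (2 * (m₂ - m₁) + 4 * h) * (2 * m₁ + h) := by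
      nlinarith [mul_nonneg (sub_nonneg.2 hm.le) (sub_nonneg.2 hle)]
    linarith [mul_le_mul_of_nonneg_left key hl.le]
  · refine (min_le_left _ _).trans ?_
    rw [div_le_div_iff₀ (by positivity) (by positivity)]
    have key : 2 * (m₁ + m₂ + h) ≤ 2 * (m₂ - m₁) + 4 * h := by linarith
    linarith [mul_le_mul_of_nonneg_left key (mul_pos hh hl).le]

/-- Consistency of the controller design inequalities is equivalent to
`(μ₁+μ₂)/(h̄ + max{h̄, 2μ₁}) > λ_N/λ₂`. -/
theorem stmt11 (hbar lam2 lamN mu1 mu2 : ℝ)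
    (hh : 0 < hbar) (hl2 : 0 < lam2) (hlN : lam2 ≤ lamN)
    (hm1 : 0 < mu1) (hm : mu1 < mu2) :
    (∃ k₁ k₂ : ℝ,
      (2 * (mu2 - mu1) / (hbar * lamN * (mu1 + mu2 + hbar)) > k₁ ∧ k₁ > 0) ∧
      (min (2 / (hbar * lamN)) (4 / (lamN * (2 * mu1 + hbar))) > k₂ ∧
        k₂ > 4 / (lam2 * (mu1 + mu2))) ∧
      (4 / (lamN * (mu1 + mu2 + hbar)) > k₂ - k₁ ∧ k₂ - k₁ > 0)) ↔
    (mu1 + mu2) / (hbar + max hbar (2 * mu1)) > lamN / lam2 := by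
  have hN : 0 < lamN := hl2.trans_le hlN
  have hm2 : 0 < mu2 := hm1.trans hm
  have hM : 0 < max hbar (2 * mu1) := lt_max_of_lt_left hh
  have window : 4 / (lam2 * (mu1 + mu2)) <
      min (2 / (hbar * lamN)) (4 / (lamN * (2 * mu1 + hbar))) ↔
      (mu1 + mu2) / (hbar + max hbar (2 * mu1)) > lamN / lam2 := by
    rw [min_two_div_four_div_eq hh hN hm1,
      div_lt_div_iff_of_pos_left (by norm_num) (by positivity) (by positivity), gt_iff_lt,
      div_lt_div_iff₀ hl2 (by positivity), mul_comm lam2]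
  rw [← window]
  constructor
  · rintro ⟨k₁, k₂, -, ⟨hlt, hgt⟩, -⟩
    exact hgt.trans hlt
  · intro hlt
    obtain ⟨k₂, hgt, hlt⟩ := exists_between hlt
    have hk₂ : 0 < k₂ := lt_trans (by positivity) hgt
    have hA : 0 < 2 * (mu2 - mu1) / (hbar * lamN * (mu1 + mu2 + hbar)) :=
      div_pos (by linarith) (by positivity)
    have hC : 0 < 4 / (lamN * (mu1 + mu2 + hbar)) := by positivity
    have hAC := hlt.trans_le (min_le_add_gain_bounds hh hN hm1 hm)
    obtain ⟨k₁, hlo, hhi⟩ : ∃ k₁, max 0 (k₂ - 4 / (lamN * (mu1 + mu2 + hbar))) < k₁ ∧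
        k₁ < min k₂ (2 * (mu2 - mu1) / (hbar * lamN * (mu1 + mu2 + hbar))) :=
      exists_between (max_lt (lt_min hk₂ hA) (lt_min (by linarith) (by linarith)))
    rw [max_lt_iff] at hlo
    rw [lt_min_iff] at hhi
    exact ⟨k₁, k₂, ⟨hhi.2, hlo.1⟩, ⟨hlt, hgt⟩, by linarith, by linarith⟩
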